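/- arXiv:1605.02419 — 3 statements merged into one kernel-verified Lean document; each statement's English description precedes it below -/
import Mathlib

section
/- Assume the Continuum Hypothesis (2^ℵ₀ = ℵ₁). Then for every mad family F on ℕ there exists a Ramsey ultrafilter U on ℕ such that U ∩ F = ∅, i.e. no member of F belongs to U. -/
/-- `A ⊆* B` : `A` is almost contained in `B`, i.e. `A \ B` is finite. -/
def AlmostSubset (A B : Set ℕ) : Prop := (A \ B).Finite

/-- An almost disjoint family: a set of infinite subsets of `ℕ`, any two distinct
members of which have finite intersection. -/
def IsAlmostDisjointFamily (F : Set (Set ℕ)) : Prop :=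
  (∀ a ∈ F, a.Infinite) ∧ ∀ a ∈ F, ∀ b ∈ F, a ≠ b → (a ∩ b).Finite

/-- A mad family: an infinite almost disjoint family not properly contained in any
almost disjoint family. -/
def IsMadFamily (F : Set (Set ℕ)) : Prop :=
  F.Infinite ∧ IsAlmostDisjointFamily F ∧
    ∀ G : Set (Set ℕ), IsAlmostDisjointFamily G → F ⊆ G → F = G

/-- A nonprincipal ultrafilter: one containing no finite set. -/
def IsNonprincipal (U : Ultrafilter ℕ) : Prop := ∀ s : Set ℕ, s.Finite → s ∉ U

/-- A Ramsey ultrafilter: for every 2-coloring of unordered pairs (coded as a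
symmetric function `f : ℕ → ℕ → Fin 2`) there is a set in the ultrafilter on whose
pairs of distinct elements `f` is constant. -/
def IsRamseyUltrafilter (U : Ultrafilter ℕ) : Prop :=
  ∀ f : ℕ → ℕ → Fin 2, (∀ i j, f i j = f j i) →
    ∃ A ∈ U, ∃ c : Fin 2, ∀ i ∈ A, ∀ j ∈ A, i ≠ j → f i j = c

open Cardinal Filter

/-- A set is positive for `F` if it meets infinitely many members of `F` in infinite sets.
For a mad family, this says that it lies outside the ideal generated by `F` and
the finite sets. -/
def IsPositive (F : Set (Set ℕ)) (S : Set ℕ) : Prop :=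
  {a ∈ F | (S ∩ a).Infinite}.Infinite

theorem AlmostSubset.of_subset {A B : Set ℕ} (h : A ⊆ B) : AlmostSubset A B := by
  simp [AlmostSubset, Set.sdiff_eq_empty.2 h]

theorem AlmostSubset.trans {A B C : Set ℕ} (h : AlmostSubset A B) (h' : AlmostSubset B C) :
    AlmostSubset A C :=
  (h.union h').subset fun x hx => by
    by_cases hB : x ∈ B
    · exact Or.inr ⟨hB, hx.2⟩
    · exact Or.inl ⟨hx.1, hB⟩

theorem AlmostSubset.iInter_le {B : Set ℕ} {A : ℕ → Set ℕ} {n : ℕ}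
    (h : ∀ i ≤ n, AlmostSubset B (A i)) : AlmostSubset B (⋂ i ≤ n, A i) :=
  ((Set.finite_Iic n).biUnion h).subset fun x hx => by
    obtain ⟨i, hi, hxi⟩ : ∃ i ≤ n, x ∉ A i := by simpa using hx.2
    exact Set.mem_iUnion₂.2 ⟨i, hi, hx.1, hxi⟩

theorem Set.Infinite.of_almostSubset {A B : Set ℕ} (hA : A.Infinite) (h : AlmostSubset A B) :
    B.Infinite := fun hB =>
  hA ((h.union hB).subset fun x hx => by
    by_cases hxB : x ∈ B
    · exact Or.inr hxB
    · exact Or.inl ⟨hx, hxB⟩)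

namespace IsPositive

variable {F : Set (Set ℕ)} {S T : Set ℕ}

theorem of_almostSubset (hS : IsPositive F S) (h : AlmostSubset S T) : IsPositive F T :=
  hS.mono fun _ ha => ⟨ha.1, ha.2.of_almostSubset (h.subset fun _ hx =>
    ⟨hx.1.1, fun hT => hx.2 ⟨hT, hx.1.2⟩⟩)⟩

theorem mono (hS : IsPositive F S) (h : S ⊆ T) : IsPositive F T :=
  hS.of_almostSubset (.of_subset h)

theorem infinite (hS : IsPositive F S) : S.Infinite := by
  obtain ⟨a, ha⟩ := hS.nonempty
  exact ha.2.mono Set.inter_subset_left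

theorem or_of_union (h : IsPositive F (S ∪ T)) : IsPositive F S ∨ IsPositive F T := by
  by_contra! hn
  unfold IsPositive at hn
  simp only [Set.not_infinite] at hn
  refine h ((hn.1.union hn.2).subset fun a ha => ?_)
  have := ha.2
  rw [Set.union_inter_distrib_right, Set.infinite_union] at this
  exact this.imp (fun h => ⟨ha.1, h⟩) (fun h => ⟨ha.1, h⟩)

/-- A positive set can be thinned out to a positive set that grows faster than `g`. -/
theorem exists_subset_sparse (hS : IsPositive F S) (g : ℕ → ℕ) :
    ∃ D ⊆ S, IsPositive F D ∧ ∀ i ∈ D, ∀ j ∈ D, i < j → g i < j := by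
  let e := hS.natEmbedding
  have key : ∀ k m : ℕ, ∃ j ∈ S ∩ (e k.unpair.1 : Set ℕ), ∀ i ≤ m, i < j ∧ g i < j := by
    intro k m
    obtain ⟨j, hj, hlt⟩ := (e k.unpair.1).2.2.exists_gt (m + (Finset.range (m + 1)).sup g)
    refine ⟨j, hj, fun i hi => ⟨by omega, ?_⟩⟩
    have : g i ≤ (Finset.range (m + 1)).sup g := Finset.le_sup (by simpa using by omega)
    omega
  choose next hmem hlt using key
  let d : ℕ → ℕ := fun n => Nat.rec (next 0 0) (fun k m => next (k + 1) m) n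
  have hd : ∀ k, d k ∈ S ∩ (e k.unpair.1 : Set ℕ) := by
    rintro (_ | k)
    · exact hmem 0 0
    · exact hmem (k + 1) (d k)
  have hmono : StrictMono d := strictMono_nat_of_lt_succ fun k => (hlt (k + 1) (d k) _ le_rfl).1
  refine ⟨Set.range d, ?_, ?_, ?_⟩
  · rintro _ ⟨k, rfl⟩
    exact (hd k).1
  · refine (Set.infinite_range_of_injective
      (Subtype.val_injective.comp e.injective)).mono ?_
    rintro _ ⟨n, rfl⟩
    refine ⟨(e n).2.1, ?_⟩
    have hinj : Function.Injective fun m => d (Nat.pair n m) := fun m m' h => by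
      have := hmono.injective h
      simpa using this
    refine (Set.infinite_range_of_injective hinj).mono ?_
    rintro _ ⟨m, rfl⟩
    refine ⟨⟨_, rfl⟩, ?_⟩
    simpa using (hd (Nat.pair n m)).2
  · rintro _ ⟨i, rfl⟩ _ ⟨j, rfl⟩ hij
    have hij' := hmono.lt_iff_lt.1 hij
    obtain ⟨k, rfl⟩ : ∃ k, j = k + 1 := ⟨j - 1, by omega⟩
    exact (hlt (k + 1) (d k) _ (hmono.monotone (by omega))).2

/-- There is an ultrafilter all of whose members have positive trace on a given positive set. -/
theorem exists_ultrafilter (hS : IsPositive F S) :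
    ∃ V : Ultrafilter ℕ, ∀ T ∈ V, IsPositive F (S ∩ T) := by
  let L : Filter ℕ :=
    { sets := {T | ¬ IsPositive F (S \ T)}
      univ_sets := fun h => by simpa using h.infinite
      sets_of_superset := fun {T R} hT h hR => hT (hR.mono (Set.sdiff_subset_sdiff_right h))
      inter_sets := fun {T R} hT hR h => by
        rw [Set.sdiff_inter] at h
        exact h.or_of_union.elim hT hR }
  have : L.NeBot := by
    refine ⟨fun h => ?_⟩
    have h0 : (∅ : Set ℕ) ∈ L := by simp [h]
    exact h0 (by simpa using hS)
  refine ⟨Ultrafilter.of L, fun T hT => ?_⟩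
  by_contra hn
  have h1 : Tᶜ ∈ L := fun h => hn (h.mono (by intro x; simp))
  exact Ultrafilter.compl_mem_iff_notMem.1 (Ultrafilter.of_le L h1) hT

end IsPositive

/-- A sequence of sets with infinite finite intersections has an infinite pseudo-intersection. -/
theorem exists_infinite_forall_almostSubset (A : ℕ → Set ℕ)
    (hA : ∀ n, (⋂ i ≤ n, A i).Infinite) : ∃ P : Set ℕ, P.Infinite ∧ ∀ n, AlmostSubset P (A n) := by
  obtain ⟨φ, hφ, h⟩ := extraction_forall_of_frequently
    (fun n => Nat.frequently_atTop_iff_infinite.2 (hA n))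
  refine ⟨Set.range φ, Set.infinite_range_of_injective hφ.injective, fun n => ?_⟩
  refine ((Set.finite_Iio n).image φ).subset ?_
  rintro _ ⟨⟨k, rfl⟩, hk⟩
  refine ⟨k, ?_, rfl⟩
  by_contra hkn
  exact hk (Set.mem_iInter₂.1 (h k) n (not_lt.1 hkn))

namespace IsMadFamily

variable {F : Set (Set ℕ)}

theorem isPositive_univ (hF : IsMadFamily F) : IsPositive F Set.univ :=
  hF.1.mono fun a ha => ⟨ha, by simpa using hF.2.1.1 a ha⟩

theorem exists_infinite_inter (hF : IsMadFamily F) {P : Set ℕ} (hP : P.Infinite) :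
    ∃ a ∈ F, (P ∩ a).Infinite := by
  by_contra! h
  have had : IsAlmostDisjointFamily (insert P F) := by
    refine ⟨?_, ?_⟩
    · rintro a (rfl | ha)
      exacts [hP, hF.2.1.1 a ha]
    · rintro a (rfl | ha) b (rfl | hb) hab
      · exact absurd rfl hab
      · exact h b hb
      · rw [Set.inter_comm]
        exact h a ha
      · exact hF.2.1.2 a ha b hb hab
  have hmem : P ∈ F := by
    rw [hF.2.2 _ had (Set.subset_insert P F)]
    exact Set.mem_insert P F
  exact hP (by simpa using h P hmem)

theorem not_isPositive_of_subset (hF : IsMadFamily F) {a S : Set ℕ} (ha : a ∈ F) (hS : S ⊆ a) :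
    ¬ IsPositive F S := fun h =>
  h ((Set.finite_singleton a).subset fun b hb => by
    by_contra hne
    exact hb.2 ((hF.2.1.2 a ha b hb.1 fun h => hne h.symm).subset
      (Set.inter_subset_inter_left b hS)))

/-- Positive sets for a mad family satisfy the P-point property. -/
theorem exists_isPositive_forall_almostSubset (hF : IsMadFamily F) (A : ℕ → Set ℕ)
    (hA : ∀ n, IsPositive F (⋂ i ≤ n, A i)) :
    ∃ B, IsPositive F B ∧ ∀ n, AlmostSubset B (A n) := by
  have hinf : {a ∈ F | ∃ Q ⊆ a, Q.Infinite ∧ ∀ n, AlmostSubset Q (A n)}.Infinite := by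
    intro hfin
    set s := {a ∈ F | ∃ Q ⊆ a, Q.Infinite ∧ ∀ n, AlmostSubset Q (A n)}
    have hC : ∀ n, (⋂ i ≤ n, A i \ ⋃₀ s).Infinite := by
      intro n
      obtain ⟨b, hb, hbs⟩ := (hA n).exists_notMem_finite hfin
      have hbfin : (b ∩ ⋃₀ s).Finite := by
        rw [Set.sUnion_eq_biUnion, Set.inter_iUnion₂]
        exact hfin.biUnion fun a ha => hF.2.1.2 b hb.1 a ha.1 fun h => hbs (h ▸ ha)
      refine (hb.2.sdiff hbfin).mono fun x hx => ?_
      exact Set.mem_iInter₂.2 fun i hi =>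
        ⟨Set.mem_iInter₂.1 hx.1.1 i hi, fun h => hx.2 ⟨hx.1.2, h⟩⟩
    obtain ⟨P, hP, hPA⟩ := exists_infinite_forall_almostSubset _ hC
    obtain ⟨a, ha, haP⟩ := hF.exists_infinite_inter hP
    have has : a ∈ s := ⟨ha, P ∩ a, Set.inter_subset_right, haP, fun n =>
      (AlmostSubset.of_subset Set.inter_subset_left).trans
        ((hPA n).trans (.of_subset Set.sdiff_subset))⟩
    refine haP ((hPA 0).subset fun x hx => ⟨hx.1, fun h => h.2 ⟨a, has, hx.2⟩⟩)
  let e := hinf.natEmbedding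
  choose Q hQe hQinf hQA using fun n => (e n).2.2
  have hQfin : ∀ n m, AlmostSubset (Q n) (⋂ i ≤ m, A i) := fun n m =>
    .iInter_le fun i _ => hQA n i
  refine ⟨⋃ n, Q n ∩ ⋂ i ≤ n, A i, ?_, fun m => ?_⟩
  · refine (Set.infinite_range_of_injective
      (Subtype.val_injective.comp e.injective)).mono ?_
    rintro _ ⟨n, rfl⟩
    refine ⟨(e n).2.1, ((hQinf n).sdiff (hQfin n n)).mono fun x hx => ?_⟩
    rw [Set.sdiff_sdiff_right_self] at hx
    exact ⟨Set.mem_iUnion.2 ⟨n, hx⟩, hQe n hx.1⟩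
  · refine ((Set.finite_Iio m).biUnion fun n _ => hQA n m).subset ?_
    rintro x ⟨hx, hxm⟩
    obtain ⟨n, hxn, hxA⟩ := Set.mem_iUnion.1 hx
    refine Set.mem_iUnion₂.2 ⟨n, ?_, hxn, hxm⟩
    by_contra hmn
    exact hxm (Set.mem_iInter₂.1 hxA m (not_lt.1 hmn))

/-- Every countable `⊆*`-chain of positive sets has a positive lower bound. -/
theorem exists_isPositive_of_countable_isChain (hF : IsMadFamily F) {C : Set (Set ℕ)}
    (hC : C.Countable) (hpos : ∀ S ∈ C, IsPositive F S)
    (hchain : ∀ S ∈ C, ∀ T ∈ C, AlmostSubset S T ∨ AlmostSubset T S) :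
    ∃ B, IsPositive F B ∧ ∀ S ∈ C, AlmostSubset B S := by
  rcases C.eq_empty_or_nonempty with rfl | hne
  · exact ⟨Set.univ, hF.isPositive_univ, by simp⟩
  obtain ⟨A, rfl⟩ := hC.exists_eq_range hne
  simp only [Set.forall_mem_range] at hpos hchain ⊢
  have hmin : ∀ n, ∃ k, ∀ i ≤ n, AlmostSubset (A k) (A i) := by
    intro n
    induction n with
    | zero => exact ⟨0, fun i hi => .of_subset (by simp_all)⟩
    | succ n ih =>
      obtain ⟨k, hk⟩ := ih
      rcases hchain k (n + 1) with h | h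
      · refine ⟨k, fun i hi => ?_⟩
        rcases Nat.le_succ_iff.1 hi with hi | rfl
        exacts [hk i hi, h]
      · refine ⟨n + 1, fun i hi => ?_⟩
        rcases Nat.le_succ_iff.1 hi with hi | rfl
        exacts [h.trans (hk i hi), .of_subset subset_rfl]
  refine hF.exists_isPositive_forall_almostSubset A fun n => ?_
  obtain ⟨k, hk⟩ := hmin n
  exact (hpos k).of_almostSubset (.iInter_le hk)

/-- Ramsey's theorem for positive sets. -/
theorem exists_isPositive_homogeneous (hF : IsMadFamily F) {S : Set ℕ} (hS : IsPositive F S)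
    {f : ℕ → ℕ → Fin 2} (hf : ∀ i j, f i j = f j i) :
    ∃ D ⊆ S, IsPositive F D ∧ ∃ c, ∀ i ∈ D, ∀ j ∈ D, i ≠ j → f i j = c := by
  obtain ⟨V, hV⟩ := hS.exists_ultrafilter
  have hc : ∀ n, ∃ c, {j | f n j = c} ∈ V := by
    intro n
    rcases V.mem_or_compl_mem {j | f n j = 0} with h | h
    · exact ⟨0, h⟩
    · exact ⟨1, mem_of_superset h fun j hj => by
        simp only [Set.mem_compl_iff, Set.mem_ofPred_eq] at hj ⊢
        omega⟩
  choose c hc using hc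
  obtain ⟨B, hB, hBA⟩ := hF.exists_isPositive_forall_almostSubset
    (fun n => S ∩ {j | f n j = c n}) fun n => by
      refine (hV (⋂ i ∈ Set.Iic n, {j | f i j = c i})
        ((biInter_mem (Set.finite_Iic n)).2 fun i _ => hc i)).mono fun x hx => ?_
      exact Set.mem_iInter₂.2 fun i hi => ⟨hx.1, Set.mem_iInter₂.1 hx.2 i hi⟩
  have hBS : IsPositive F (B ∩ S) := hB.of_almostSubset <|
    (hBA 0).subset fun x hx => ⟨hx.1, fun h => hx.2 ⟨hx.1, h.1⟩⟩
  have hsplit : ∃ k, IsPositive F (B ∩ S ∩ {n | c n = k}) := by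
    have : B ∩ S = (B ∩ S ∩ {n | c n = 0}) ∪ (B ∩ S ∩ {n | c n = 1}) := by
      ext n
      have : c n = 0 ∨ c n = 1 := by omega
      simp only [Set.mem_union, Set.mem_inter_iff, Set.mem_ofPred_eq]
      tauto
    rw [this] at hBS
    exact hBS.or_of_union.elim (fun h => ⟨0, h⟩) (fun h => ⟨1, h⟩)
  obtain ⟨k, hk⟩ := hsplit
  choose g hg using fun n => (hBA n).bddAbove
  obtain ⟨D, hDS, hD, hDg⟩ := hk.exists_subset_sparse g
  have hlt : ∀ i ∈ D, ∀ j ∈ D, i < j → f i j = k := by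
    intro i hi j hj hij
    by_contra hne
    have hci : c i = k := (hDS hi).2
    exact (hDg i hi j hj hij).not_ge (hg i ⟨(hDS hj).1.1, fun h => hne (h.2.trans hci)⟩)
  refine ⟨D, fun x hx => (hDS hx).1.2, hD, k, fun i hi j hj hij => ?_⟩
  rcases hij.lt_or_gt with h | h
  · exact hlt i hi j hj h
  · rw [hf]
    exact hlt j hj i hi h

end IsMadFamily

/-- In a `σ`-closed order, `ℵ₁` many dense sets are met by a chain. -/
theorem exists_chain_meeting_dense {X P : Type*} (hX : #X = ℵ₁) [Nonempty P] (r : P → P → Prop)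
    (htrans : ∀ p q s, r p q → r q s → r p s) (D : X → Set P) (hD : ∀ x p, ∃ q ∈ D x, r q p)
    (hclosed : ∀ C : Set P, C.Countable → (∀ p ∈ C, ∀ q ∈ C, p ≠ q → r p q ∨ r q p) →
      ∃ p, ∀ q ∈ C, r p q) :
    ∃ A : X → P, (∀ x, A x ∈ D x) ∧ ∀ x y, x ≠ y → r (A x) (A y) ∨ r (A y) (A x) := by
  obtain ⟨_, _, hlt⟩ := Cardinal.exists_ord_eq_type_lt X
  have hcount : ∀ x : X, (Set.Iio x).Countable := by
    intro x
    have h := Cardinal.mk_Iio_lt x hlt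
    rwa [hX, ← Cardinal.succ_aleph0, Order.lt_succ_iff, Cardinal.le_aleph0_iff_set_countable] at h
  have hwf : WellFounded ((· < ·) : X → X → Prop) := wellFounded_lt
  let good (x : X) (A : ∀ y, y < x → P) (p : P) : Prop := p ∈ D x ∧ ∀ y h, r p (A y h)
  let A : X → P := hwf.fix fun x A => Classical.epsilon (good x A)
  have hA : ∀ x, good x (fun y _ => A y) (A x) := by
    intro x
    induction x using hwf.induction with
    | _ x ih =>
      have hex : ∃ p, good x (fun y _ => A y) p := by
        obtain ⟨p, hp⟩ := hclosed (A '' Set.Iio x) ((hcount x).image A) (by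
          rintro _ ⟨y, hy, rfl⟩ _ ⟨z, hz, rfl⟩ hne
          rcases lt_trichotomy y z with h | rfl | h
          · exact Or.inr ((ih z hz).2 y h)
          · exact absurd rfl hne
          · exact Or.inl ((ih y hy).2 z h))
        obtain ⟨q, hq, hqp⟩ := hD x p
        exact ⟨q, hq, fun y hy => htrans _ _ _ hqp (hp _ ⟨y, hy, rfl⟩)⟩
      have heq : A x = Classical.epsilon (good x fun y _ => A y) := hwf.fix_eq _ x
      rw [heq]
      exact Classical.epsilon_spec hex
  refine ⟨A, fun x => (hA x).1, fun x y hne => ?_⟩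
  rcases lt_trichotomy x y with h | h | h
  · exact Or.inr ((hA y).2 x h)
  · exact absurd h hne
  · exact Or.inl ((hA x).2 y h)

/-- A nonempty `⊆*`-chain of infinite sets is contained in a nonprincipal ultrafilter. -/
theorem exists_nonprincipal_ultrafilter_of_chain {X : Type*} [Nonempty X] (A : X → Set ℕ)
    (hA : ∀ x, (A x).Infinite)
    (hchain : ∀ x y, AlmostSubset (A x) (A y) ∨ AlmostSubset (A y) (A x)) :
    ∃ U : Ultrafilter ℕ, IsNonprincipal U ∧ ∀ x, A x ∈ U := by
  have hmono : ∀ x y, AlmostSubset (A x) (A y) →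
      cofinite ⊓ 𝓟 (A x) ≤ cofinite ⊓ 𝓟 (A y) := by
    refine fun x y h => le_inf inf_le_left (le_principal_iff.2 ?_)
    rw [mem_inf_principal, mem_cofinite]
    exact h.subset fun n hn => by simpa using hn
  have hne : (⨅ x, cofinite ⊓ 𝓟 (A x)).NeBot := by
    have : ∀ x, (cofinite ⊓ 𝓟 (A x)).NeBot := fun x => (hA x).cofinite_inf_principal_neBot
    refine iInf_neBot_of_directed' (fun x y => ?_) this
    rcases hchain x y with h | h
    · exact ⟨x, le_rfl, hmono x y h⟩
    · exact ⟨y, hmono y x h, le_rfl⟩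
  let U := Ultrafilter.of (⨅ x, cofinite ⊓ 𝓟 (A x))
  have hU : ∀ x, (U : Filter ℕ) ≤ cofinite ⊓ 𝓟 (A x) := fun x =>
    (Ultrafilter.of_le _).trans (iInf_le _ x)
  refine ⟨U, fun s hs hsU => ?_, fun x => le_principal_iff.1 ((hU x).trans inf_le_right)⟩
  obtain ⟨x⟩ := ‹Nonempty X›
  exact Ultrafilter.compl_mem_iff_notMem.1
    (((hU x).trans inf_le_left) hs.compl_mem_cofinite) hsU

/-- Under CH, for every mad family `F` there is a Ramsey ultrafilter disjoint from `F`. -/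
theorem ch_mad_family_ramsey_ultrafilter_disjoint
    (hCH : Cardinal.continuum = Cardinal.aleph 1)
    (F : Set (Set ℕ)) (hF : IsMadFamily F) :
    ∃ U : Ultrafilter ℕ, IsNonprincipal U ∧ IsRamseyUltrafilter U ∧
      ∀ a ∈ F, a ∉ U := by
  classical
  have hCH' : Cardinal.continuum.{0} = Cardinal.aleph 1 :=
    Cardinal.lift_injective (by simpa using hCH)
  let P := {S : Set ℕ // IsPositive F S}
  have : Nonempty P := ⟨⟨Set.univ, hF.isPositive_univ⟩⟩
  let D (f : ℕ → ℕ → Fin 2) : Set P :=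
    {S | (∀ i j, f i j = f j i) → ∃ c, ∀ i ∈ S.1, ∀ j ∈ S.1, i ≠ j → f i j = c}
  obtain ⟨A, hAD, hchain⟩ := exists_chain_meeting_dense (X := ℕ → ℕ → Fin 2)
    (by simpa using hCH') (fun S T : P => AlmostSubset S.1 T.1) (fun _ _ _ h h' => h.trans h') D
    (fun f S => by
      by_cases hf : ∀ i j, f i j = f j i
      · obtain ⟨T, hTS, hT, h⟩ := hF.exists_isPositive_homogeneous S.2 hf
        exact ⟨⟨T, hT⟩, fun _ => h, .of_subset hTS⟩
      · exact ⟨S, fun h => absurd h hf, .of_subset subset_rfl⟩)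
    (fun C hC hch => by
      obtain ⟨B, hB, h⟩ := hF.exists_isPositive_of_countable_isChain (hC.image Subtype.val)
        (by rintro _ ⟨S, -, rfl⟩; exact S.2)
        (by
          rintro _ ⟨S, hS, rfl⟩ _ ⟨T, hT, rfl⟩
          by_cases hST : S = T
          · exact Or.inl (.of_subset (by rw [hST]))
          · exact hch S hS T hT hST)
      exact ⟨⟨B, hB⟩, fun S hS => h _ ⟨S, hS, rfl⟩⟩)
  obtain ⟨U, hU, hAU⟩ := exists_nonprincipal_ultrafilter_of_chain (fun f => (A f).1)
    (fun f => (A f).2.infinite) (fun f g => by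
      by_cases hfg : f = g
      · exact Or.inl (.of_subset (by rw [hfg]))
      · exact hchain f g hfg)
  refine ⟨U, hU, fun f hf => ⟨_, hAU f, hAD f hf⟩, fun a ha haU => ?_⟩
  -- Homogeneous sets for this coloring with three points lie inside `a` or its complement.
  let f : ℕ → ℕ → Fin 2 := fun i j => if (i ∈ a ↔ j ∈ a) then 0 else 1
  obtain ⟨c, hc⟩ := hAD f fun i j => by simp only [f, iff_comm]
  obtain ⟨i, hiA, hia⟩ := U.nonempty_of_mem (inter_mem (hAU f) haU)
  obtain ⟨j, hjA, hja⟩ := Set.not_subset.1 fun h => hF.not_isPositive_of_subset ha h (A f).2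
  obtain ⟨k, hkA, hk⟩ := (A f).2.infinite.exists_notMem_finite (Set.toFinite {i, j})
  simp only [Set.mem_insert_iff, Set.mem_singleton_iff, not_or] at hk
  have hij := hc i hiA j hjA fun h => hja (h ▸ hia)
  have hik := hc i hiA k hkA (Ne.symm hk.1)
  have hjk := hc j hjA k hkA (Ne.symm hk.2)
  by_cases hka : k ∈ a <;> simp [f, hia, hja, hka] at hij hik hjk <;> omega
end

section
/- Let A ⊆ ℕ be infinite and let f : ℕ → ℕ → {0,1} be symmetric. Suppose: (a) for every n ∈ ℕ there exist l_n ∈ {0,1} and k_n ∈ ℕ such that f(k,n) = l_n for every k ∈ A with k ≥ k_n; (b) there exist k* ∈ ℕ and l* ∈ {0,1} such that l_n = l* for every n ∈ A with n ≥ k*; and (c) (b_m)_{m<ω} is a sequence of infinite subsets of A. Then there exists an infinite set B ⊆ A such that f takes the constant value l* on all pairs of distinct elements of B, and B ∩ b_m is infinite for every m < ω. -/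
/-- Elements of infinite sets of naturals can be chosen successively, each exceeding a prescribed
function of its predecessor. -/
theorem exists_seq_mem_lt_succ {s : ℕ → Set ℕ} (hs : ∀ i, (s i).Infinite) (N : ℕ) (g : ℕ → ℕ) :
    ∃ u : ℕ → ℕ, (∀ i, u i ∈ s i) ∧ N < u 0 ∧ ∀ i, g (u i) < u (i + 1) := by
  choose next hmem hlt using fun i n => (hs i).exists_gt n
  refine ⟨fun i => Nat.rec (next 0 N) (fun i n => next (i + 1) (g n)) i, ?_, hlt 0 N,
    fun i => hlt (i + 1) _⟩
  rintro (_ | i)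
  exacts [hmem 0 N, hmem (i + 1) _]

/-- Case III of the proof of Subclaim 3a: given an infinite set `A`, a symmetric
coloring `f` which is eventually (on `A`) constant in each coordinate with limit
colors themselves eventually constant on `A`, and countably many infinite subsets
`b m ⊆ A`, there is an infinite `B ⊆ A` on whose pairs `f` is constantly `lstar`
and which meets every `b m` infinitely. -/
theorem case_III_homogeneous_set
    (A : Set ℕ) (hA : A.Infinite)
    (f : ℕ → ℕ → Fin 2) (hsymm : ∀ i j, f i j = f j i)
    (l : ℕ → Fin 2) (k : ℕ → ℕ)
    (ha : ∀ n : ℕ, ∀ m ∈ A, k n ≤ m → f m n = l n)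
    (kstar : ℕ) (lstar : Fin 2)
    (hb : ∀ n ∈ A, kstar ≤ n → l n = lstar)
    (b : ℕ → Set ℕ) (hbsub : ∀ m, b m ⊆ A) (hbinf : ∀ m, (b m).Infinite) :
    ∃ B : Set ℕ, B ⊆ A ∧ B.Infinite ∧
      (∀ i ∈ B, ∀ j ∈ B, i ≠ j → f i j = lstar) ∧
      ∀ m : ℕ, (B ∩ b m).Infinite := by
  obtain ⟨u, hu, hu0, hstep⟩ := exists_seq_mem_lt_succ (fun i => hbinf (Nat.unpair i).1) kstar
    fun n => n + ∑ j ∈ Finset.range (n + 1), k j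
  have hmono : StrictMono u := strictMono_nat_of_lt_succ fun i =>
    (Nat.le_add_right _ _).trans_lt (hstep i)
  have huA : ∀ i, u i ∈ A := fun i => hbsub _ (hu i)
  have hcolor : ∀ i j, i < j → f (u j) (u i) = lstar := by
    intro i j hij
    have hk : k (u i) ≤ u j := by
      have h1 : k (u i) ≤ ∑ n ∈ Finset.range (u i + 1), k n :=
        Finset.single_le_sum (fun _ _ => Nat.zero_le _) (Finset.self_mem_range_succ (u i))
      have h2 : u (i + 1) ≤ u j := hmono.monotone hij
      have h3 := hstep i
      omega
    rw [ha _ _ (huA j) hk]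
    exact hb _ (huA i) (hu0.le.trans (hmono.monotone i.zero_le))
  refine ⟨Set.range u, Set.range_subset_iff.2 huA, Set.infinite_range_of_injective hmono.injective,
    ?_, fun m => ?_⟩
  · rintro _ ⟨i, rfl⟩ _ ⟨j, rfl⟩ hne
    rcases lt_or_gt_of_ne (ne_of_apply_ne u hne) with h | h
    · rw [hsymm]
      exact hcolor i j h
    · exact hcolor j i h
  · refine Set.infinite_of_injective_forall_mem (f := fun n => u (Nat.pair m n)) ?_ fun n =>
      ⟨⟨_, rfl⟩, ?_⟩
    · intro n n' h
      exact (Nat.pair_eq_pair.1 (hmono.injective h)).2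
    · simpa using hu (Nat.pair m n)
end

section
/- Let Q be a ccc preorder and let Z ⊆ Q be a subset such that: (i) for all p, q ∈ Z that are compatible in Q there exists r ∈ Z with r ≤ p and r ≤ q; and (ii) for every countable X ⊆ Z that is not predense in Q there exists z ∈ Z that is incompatible in Q with every member of X. Then every subset A ⊆ Z whose elements are pairwise incompatible in Q and which is maximal with this property among subsets of Z is predense in Q. -/
/-- Two conditions are compatible if they have a common lower bound. -/
def Compatible {Q : Type*} [Preorder Q] (p q : Q) : Prop := ∃ r, r ≤ p ∧ r ≤ q

/-- `X` is predense in `Q`: every element of `Q` is compatible with a member of `X`. -/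
def Predense {Q : Type*} [Preorder Q] (X : Set Q) : Prop :=
  ∀ q : Q, ∃ x ∈ X, Compatible q x

/-- The countable chain condition: every set of pairwise incompatible elements is
countable. -/
def CCC (Q : Type*) [Preorder Q] : Prop :=
  ∀ A : Set Q, (∀ p ∈ A, ∀ q ∈ A, p ≠ q → ¬ Compatible p q) → A.Countable

/-- The closure argument at stage `i = 3j+2` of Subclaim 1: if `Z` is closed under
common lower bounds of compatible pairs, and every countable non-predense subset of
`Z` has a member of `Z` incompatible with all of it, then every maximal antichain
of `Q` contained in `Z` is predense in `Q`. -/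
theorem maximal_antichain_in_closed_subset_predense
    {Q : Type*} [Preorder Q] (hccc : CCC Q) (Z : Set Q)
    (h1 : ∀ p ∈ Z, ∀ q ∈ Z, Compatible p q → ∃ r ∈ Z, r ≤ p ∧ r ≤ q)
    (h2 : ∀ X ⊆ Z, X.Countable → ¬ Predense X →
      ∃ z ∈ Z, ∀ x ∈ X, ¬ Compatible z x)
    (A : Set Q) (hAZ : A ⊆ Z)
    (hanti : ∀ p ∈ A, ∀ q ∈ A, p ≠ q → ¬ Compatible p q)
    (hmax : ∀ A' : Set Q, A' ⊆ Z → A ⊆ A' →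
      (∀ p ∈ A', ∀ q ∈ A', p ≠ q → ¬ Compatible p q) → A' = A) :
    Predense A := by
  by_contra hA
  obtain ⟨z, hzZ, hz⟩ := h2 A hAZ (hccc A hanti) hA
  have hz' : ∀ x ∈ A, ¬ Compatible x z := fun x hx ⟨r, hrx, hrz⟩ => hz x hx ⟨r, hrz, hrx⟩
  have hinsert : insert z A = A := by
    refine hmax _ (Set.insert_subset hzZ hAZ) (Set.subset_insert z A) ?_
    rintro p (rfl | hp) q (rfl | hq) hpq
    · exact absurd rfl hpq
    · exact hz q hq
    · exact hz' p hp
    · exact hanti p hp q hq hpq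
  exact hz z (hinsert ▸ Set.mem_insert z A) ⟨z, le_rfl, le_rfl⟩
end
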